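/- For every trajectory τ of length T, i.e. states s : Fin (T+1) → S and actions a : Fin T → A, the optimal trajectory density satisfies D_{π*}(s,a) = (∏_{t<T} Z(s t))⁻¹ · D_μ(s,a) · exp(β · ∑_{t<T} Q(s t, a t)). In particular, given the initial state s 0, the optimal policy's trajectory density over state–action sequences is proportional to the behavior trajectory density times exp(β · ∑_{t<T} Q(s t, a t)), with explicit proportionality factor (∏_{t<T} Z(s t))⁻¹. -/

import Mathlib

open Real

/-- Theorem 2 (optimal policy in the raw action space): the optimal trajectory density over
state–action sequences `τ = (s, a)` equals `(∏ₜ Z (s t))⁻¹` times the behavior trajectory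
density times `exp (β · ∑ₜ Q (s t, a t))`. -/
theorem optimal_policy_trajectory_density
    {S A : Type*} (T : ℕ)
    (μ : S → A → ℝ) (hμ : ∀ s a, 0 ≤ μ s a)
    (Q : S → A → ℝ) (β : ℝ) (hβ : 0 ≤ β)
    (Z : S → ℝ) (hZ : ∀ s, 0 < Z s)
    (piStar : S → A → ℝ)
    (hpiStar : ∀ s a, piStar s a = μ s a * Real.exp (β * Q s a) / Z s)
    (P : S → A → S → ℝ) (hP : ∀ s a s', 0 ≤ P s a s')
    (s : Fin (T + 1) → S) (a : Fin T → A) :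
    (∏ t : Fin T, piStar (s t.castSucc) (a t) * P (s t.castSucc) (a t) (s t.succ))
      = (∏ t : Fin T, Z (s t.castSucc))⁻¹
        * (∏ t : Fin T, μ (s t.castSucc) (a t) * P (s t.castSucc) (a t) (s t.succ))
        * Real.exp (β * ∑ t : Fin T, Q (s t.castSucc) (a t)) := by
  rw [Finset.mul_sum, Real.exp_sum, ← Finset.prod_inv_distrib, ← Finset.prod_mul_distrib,
    ← Finset.prod_mul_distrib]
  refine Finset.prod_congr rfl fun t _ => ?_
  rw [hpiStar]
  ring
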